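/- Every smooth solution u of the minimal hypersurface equation div(Du/√(1+|Du|²)) = 0 on Euclidean space ℝⁿ satisfying limsup_{|x|→∞} max{-u(x),0}/|x| = 0 is constant. -/

import Mathlib

open Filter Topology

section DerivativeTest

theorem deriv_deriv_nonneg_of_isLocalMin {f f' : ℝ → ℝ} {f'' x : ℝ} (hmin : IsLocalMin f x)
    (hf : ∀ t, HasDerivAt f (f' t) t) (hf' : HasDerivAt f' f'' x) : 0 ≤ f'' := by
  have hd : deriv f = f' := funext fun t => (hf t).deriv
  by_contra! hneg
  have hmax : IsLocalMax f x := by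
    refine isLocalMax_of_deriv_deriv_neg ?_ hmin.deriv_eq_zero (hf x).continuousAt
    rwa [hd, hf'.deriv]
  have heq : f =ᶠ[𝓝 x] fun _ => f x := by
    filter_upwards [hmin, hmax] with t h₁ h₂ using le_antisymm h₂ h₁
  have hzero : deriv (deriv f) x = 0 := by
    rw [heq.deriv.deriv_eq]
    simp
  rw [hd, hf'.deriv] at hzero
  exact hneg.ne hzero

end DerivativeTest

section Graph

variable {ι E : Type*} [Fintype ι] [NormedAddCommGroup E] [InnerProductSpace ℝ E]

open scoped InnerProductSpace

/-- Coordinate representation of an orthonormal frame on the graph with gradient `p`. -/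
noncomputable def graphFrame (e : OrthonormalBasis ι ℝ E) (p : E) (k : ι) : E :=
  e k - ((√(1 + ‖p‖ ^ 2) * (√(1 + ‖p‖ ^ 2) + 1))⁻¹ * ⟪e k, p⟫_ℝ) • p

theorem sum_graphFrame (e : OrthonormalBasis ι ℝ E) (p : E) (B : E →L[ℝ] E →L[ℝ] ℝ) :
    ∑ k, B (graphFrame e p k) (graphFrame e p k) =
      ∑ k, B (e k) (e k) - B p p / (1 + ‖p‖ ^ 2) := by
  set W := √(1 + ‖p‖ ^ 2) with hW
  have hW2 : W ^ 2 = 1 + ‖p‖ ^ 2 := Real.sq_sqrt (by positivity)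
  have hW0 : 0 < W := Real.sqrt_pos.2 (by positivity)
  set s := (W * (W + 1))⁻¹ with hs
  have hexp : ∀ k, B (graphFrame e p k) (graphFrame e p k) =
      B (e k) (e k) - s * B (⟪e k, p⟫_ℝ • e k) p - s * B p (⟪e k, p⟫_ℝ • e k)
        + s ^ 2 * ⟪e k, p⟫_ℝ ^ 2 * B p p := by
    intro k
    simp only [graphFrame, ← hW, ← hs, map_sub, map_smul, sub_apply,
      smul_apply, smul_eq_mul]
    ring
  have hsum : ∑ k, ⟪e k, p⟫_ℝ • e k = p := e.sum_repr' p
  have hsq : ∑ k, ⟪e k, p⟫_ℝ ^ 2 = ‖p‖ ^ 2 := by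
    simpa using e.sum_sq_norm_inner_right p
  have h₁ : ∑ k, B (⟪e k, p⟫_ℝ • e k) p = B p p := by
    conv_rhs => enter [1]; rw [← hsum]
    rw [map_sum, _root_.sum_apply]
  have h₂ : ∑ k, B p (⟪e k, p⟫_ℝ • e k) = B p p := by
    rw [← map_sum, hsum]
  rw [Finset.sum_congr rfl fun k _ => hexp k]
  simp only [Finset.sum_add_distrib, Finset.sum_sub_distrib, ← Finset.mul_sum, ← Finset.sum_mul,
    h₁, h₂, hsq]
  have hp : ‖p‖ ^ 2 = W ^ 2 - 1 := by linarith
  rw [hp, hs]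
  field_simp
  ring

theorem sum_inner_graphFrame_sq (e : OrthonormalBasis ι ℝ E) (p w : E) :
    ∑ k, ⟪w, graphFrame e p k⟫_ℝ ^ 2 = ‖w‖ ^ 2 - ⟪w, p⟫_ℝ ^ 2 / (1 + ‖p‖ ^ 2) := by
  have h := sum_graphFrame e p ((innerSL ℝ w).smulRight (innerSL ℝ w))
  have hsq : ∑ k, ⟪w, e k⟫_ℝ ^ 2 = ‖w‖ ^ 2 := by
    simpa using e.sum_sq_norm_inner_left w
  simpa [← sq, hsq] using h

theorem sum_norm_graphFrame_sq (e : OrthonormalBasis ι ℝ E) (p : E) :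
    ∑ k, ‖graphFrame e p k‖ ^ 2 ≤ Fintype.card ι := by
  have h : ∑ k, ‖graphFrame e p k‖ ^ 2 = Fintype.card ι - ‖p‖ ^ 2 / (1 + ‖p‖ ^ 2) := by
    have h := sum_graphFrame e p ((innerSL ℝ).comp (ContinuousLinearMap.id ℝ E))
    simp only [ContinuousLinearMap.comp_apply, innerSL_apply_apply] at h
    simpa using h
  rw [h]
  have : 0 ≤ ‖p‖ ^ 2 / (1 + ‖p‖ ^ 2) := by positivity
  linarith

/-- Algebraic form of the superharmonicity of the vertical component of the unit normal:
`H` and `T` stand for the first two derivatives of the gradient `p`. -/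
theorem sum_graphFrame_angle_nonpos (e : OrthonormalBasis ι ℝ E) (p : E) (H : E →L[ℝ] E)
    (T : E →L[ℝ] E →L[ℝ] E) (hH : ∀ a b, ⟪H a, b⟫_ℝ = ⟪H b, a⟫_ℝ)
    (hT : ∀ a b, T a b = T b a) (hT' : ∀ a b c, ⟪T a b, c⟫_ℝ = ⟪T a c, b⟫_ℝ)
    (heq : (1 + ‖p‖ ^ 2) * ∑ k, ⟪H (e k), e k⟫_ℝ = ⟪p, H p⟫_ℝ)
    (heq' : 2 * ⟪p, H p⟫_ℝ * ∑ k, ⟪H (e k), e k⟫_ℝ + (1 + ‖p‖ ^ 2) * ∑ k, ⟪T p (e k), e k⟫_ℝ =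
      2 * ‖H p‖ ^ 2 + ⟪p, T p p⟫_ℝ) :
    ∑ k, (3 * ⟪p, H (graphFrame e p k)⟫_ℝ ^ 2 - (1 + ‖p‖ ^ 2) *
      (‖H (graphFrame e p k)‖ ^ 2 + ⟪p, T (graphFrame e p k) (graphFrame e p k)⟫_ℝ)) ≤ 0 := by
  set q := 1 + ‖p‖ ^ 2 with hq
  have hq0 : 0 < q := by positivity
  set b := graphFrame e p
  have hA := sum_inner_graphFrame_sq e p (H p)
  rw [← hq] at hA
  have hflip : ∀ k, ⟪p, H (b k)⟫_ℝ = ⟪H p, b k⟫_ℝ := fun k => by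
    rw [real_inner_comm, hH]
  have hTT : ∀ a, ⟪p, T a a⟫_ℝ = ⟪T p a, a⟫_ℝ := fun a => by
    rw [real_inner_comm, hT', hT]
  have hTsum : ∑ k, ⟪p, T (b k) (b k)⟫_ℝ = ∑ k, ⟪T p (e k), e k⟫_ℝ - ⟪p, T p p⟫_ℝ / q := by
    rw [Finset.sum_congr rfl fun k _ => hTT (b k), hTT p]
    have := sum_graphFrame e p ((innerSL ℝ).comp (T p))
    simpa using this
  have hCS : ∀ k, ⟪H p, b k⟫_ℝ ^ 2 ≤ q * ‖H (b k)‖ ^ 2 := fun k => by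
    rw [← hflip]
    have h₁ := abs_real_inner_le_norm p (H (b k))
    have h₂ : ⟪p, H (b k)⟫_ℝ ^ 2 ≤ (‖p‖ * ‖H (b k)‖) ^ 2 := by
      rw [← sq_abs]; gcongr
    nlinarith [sq_nonneg ‖H (b k)‖]
  have hCSsum := Finset.sum_le_sum fun k (_ : k ∈ Finset.univ) => hCS k
  rw [← Finset.mul_sum] at hCSsum
  simp only [hflip]
  rw [Finset.sum_sub_distrib, ← Finset.mul_sum, ← Finset.mul_sum, Finset.sum_add_distrib, hTsum,
    mul_add]
  rw [hA] at hCSsum ⊢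
  set t := ∑ k, ⟪H (e k), e k⟫_ℝ
  set t' := ∑ k, ⟪T p (e k), e k⟫_ℝ
  rw [real_inner_comm] at heq heq'
  have ht : t = ⟪H p, p⟫_ℝ / q := by field_simp; linarith
  have : q * (t' - ⟪p, T p p⟫_ℝ / q) = 2 * (‖H p‖ ^ 2 - ⟪H p, p⟫_ℝ ^ 2 / q) := by
    rw [ht] at heq'
    field_simp at heq' ⊢
    linarith
  linarith

section Calculus

theorem contDiff_gradient [CompleteSpace E] {u : E → ℝ} (hu : ContDiff ℝ (⊤ : ℕ∞) u) :
    ContDiff ℝ (⊤ : ℕ∞) (gradient u) :=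
  (InnerProductSpace.toDual ℝ E).symm.toContinuousLinearEquiv.contDiff.comp
    (hu.fderiv_right (by simp))

theorem inner_fderiv_gradient [CompleteSpace E] {u : E → ℝ} (hu : ContDiff ℝ (⊤ : ℕ∞) u)
    (x a b : E) : ⟪fderiv ℝ (gradient u) x a, b⟫_ℝ = fderiv ℝ (fderiv ℝ u) x a b := by
  have h₁ : HasFDerivAt (gradient u) (fderiv ℝ (gradient u) x) x :=
    ((contDiff_gradient hu).differentiable (by simp) x).hasFDerivAt
  have h₂ : HasFDerivAt (fderiv ℝ u) (fderiv ℝ (fderiv ℝ u) x) x :=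
    ((hu.fderiv_right (m := (⊤ : ℕ∞)) (by simp)).differentiable (by simp) x).hasFDerivAt
  have h₃ := h₁.inner ℝ (hasFDerivAt_const b x)
  have h₄ : HasFDerivAt (fun y => ⟪gradient u y, b⟫_ℝ)
      ((ContinuousLinearMap.apply ℝ ℝ b).comp (fderiv ℝ (fderiv ℝ u) x)) x := by
    simpa [gradient, Function.comp_def] using
      (ContinuousLinearMap.apply ℝ ℝ b).hasFDerivAt.comp x h₂
  simpa using DFunLike.congr_fun (h₃.unique h₄) a

theorem inner_fderiv_gradient_comm [CompleteSpace E] {u : E → ℝ}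
    (hu : ContDiff ℝ (⊤ : ℕ∞) u) (x a b : E) :
    ⟪fderiv ℝ (gradient u) x a, b⟫_ℝ = ⟪fderiv ℝ (gradient u) x b, a⟫_ℝ := by
  rw [inner_fderiv_gradient hu, inner_fderiv_gradient hu]
  refine (hu.contDiffAt.isSymmSndFDerivAt ?_) a b
  simp only [minSmoothness_of_isRCLikeNormedField]
  exact WithTop.coe_le_coe.2 (le_top : (2 : ℕ∞) ≤ ⊤)

/-- The second derivative of a smooth vector field with symmetric derivative is symmetric in its
last two arguments. -/
theorem inner_fderiv_fderiv_comm {P : E → E} (hP : ContDiff ℝ (⊤ : ℕ∞) P)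
    (hsymm : ∀ x a b, ⟪fderiv ℝ P x a, b⟫_ℝ = ⟪fderiv ℝ P x b, a⟫_ℝ) (x a b c : E) :
    ⟪fderiv ℝ (fderiv ℝ P) x a b, c⟫_ℝ = ⟪fderiv ℝ (fderiv ℝ P) x a c, b⟫_ℝ := by
  have hH : HasFDerivAt (fderiv ℝ P) (fderiv ℝ (fderiv ℝ P) x) x :=
    ((hP.fderiv_right (m := (⊤ : ℕ∞)) (by simp)).differentiable (by simp) x).hasFDerivAt
  have key : ∀ b c, HasFDerivAt (fun y => ⟪fderiv ℝ P y b, c⟫_ℝ) _ x := fun b c =>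
    (hH.clm_apply (hasFDerivAt_const b x)).inner ℝ (hasFDerivAt_const c x)
  have h := key b c
  simp_rw [fun y => hsymm y b c] at h
  simpa using DFunLike.congr_fun (h.unique (key c b)) a

theorem hasFDerivAt_inv_sqrt_one_add_norm_sq {F : Type*} [NormedAddCommGroup F] [NormedSpace ℝ F]
    {P : F → E} {x : F} {H : F →L[ℝ] E} (hP : HasFDerivAt P H x) :
    HasFDerivAt (fun y => (√(1 + ‖P y‖ ^ 2))⁻¹)
      (-((√(1 + ‖P x‖ ^ 2))⁻¹ ^ 3) • (innerSL ℝ (P x)).comp H) x := by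
  have h₀ : (0 : ℝ) < 1 + ‖P x‖ ^ 2 := by positivity
  have h₁ := ((hP.norm_sq.const_add 1).sqrt h₀.ne')
  have h₂ := (hasDerivAt_inv (Real.sqrt_pos.2 h₀).ne').comp_hasFDerivAt x h₁
  refine h₂.congr_fderiv ?_
  ext a
  simp only [smul_apply, ContinuousLinearMap.comp_apply, smul_eq_mul,
    innerSL_apply_apply]
  have := Real.sqrt_pos.2 h₀
  field_simp
  simp

theorem hasDerivAt_inv_sqrt_one_add_norm_sq {P : ℝ → E} {t : ℝ} {h : E} (hP : HasDerivAt P h t) :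
    HasDerivAt (fun s => (√(1 + ‖P s‖ ^ 2))⁻¹) (-((√(1 + ‖P t‖ ^ 2))⁻¹ ^ 3) * ⟪P t, h⟫_ℝ) t := by
  simpa using (hasFDerivAt_inv_sqrt_one_add_norm_sq hP.hasFDerivAt).hasDerivAt

/-- The minimal surface equation in nondivergence form. -/
theorem one_add_norm_sq_mul_laplacian_eq (e : OrthonormalBasis ι ℝ E) {P : E → E} {x : E}
    (hP : DifferentiableAt ℝ P x)
    (hsymm : ∀ a b, ⟪fderiv ℝ P x a, b⟫_ℝ = ⟪fderiv ℝ P x b, a⟫_ℝ)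
    (hmin : ∑ i, fderiv ℝ (fun y => (√(1 + ‖P y‖ ^ 2))⁻¹ * ⟪e i, P y⟫_ℝ) x (e i) = 0) :
    (1 + ‖P x‖ ^ 2) * ∑ k, ⟪fderiv ℝ P x (e k), e k⟫_ℝ = ⟪P x, fderiv ℝ P x (P x)⟫_ℝ := by
  set W := √(1 + ‖P x‖ ^ 2) with hW
  have hW2 : W ^ 2 = 1 + ‖P x‖ ^ 2 := Real.sq_sqrt (by positivity)
  have hW0 : 0 < W := Real.sqrt_pos.2 (by positivity)
  have hterm : ∀ i, fderiv ℝ (fun y => (√(1 + ‖P y‖ ^ 2))⁻¹ * ⟪e i, P y⟫_ℝ) x (e i) =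
      W⁻¹ * ⟪fderiv ℝ P x (e i), e i⟫_ℝ
        - W⁻¹ ^ 3 * ⟪fderiv ℝ P x (P x), ⟪e i, P x⟫_ℝ • e i⟫_ℝ := fun i => by
    have h := (hasFDerivAt_inv_sqrt_one_add_norm_sq hP.hasFDerivAt).fun_mul
      ((hasFDerivAt_const (e i) x).inner ℝ hP.hasFDerivAt)
    rw [HasFDerivAt.fderiv h, ← hW, inner_smul_right, hsymm (P x)]
    simp [real_inner_comm]
    ring
  rw [Finset.sum_congr rfl fun i _ => hterm i, Finset.sum_sub_distrib, ← Finset.mul_sum,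
    ← Finset.mul_sum, ← inner_sum, e.sum_repr'] at hmin
  rw [← hW2, real_inner_comm]
  field_simp at hmin
  linarith

theorem fderiv_minimal_equation (e : OrthonormalBasis ι ℝ E) {P : E → E}
    (hP : ContDiff ℝ (⊤ : ℕ∞) P)
    (hsymm : ∀ x a b, ⟪fderiv ℝ P x a, b⟫_ℝ = ⟪fderiv ℝ P x b, a⟫_ℝ)
    (heq : ∀ x, (1 + ‖P x‖ ^ 2) * ∑ k, ⟪fderiv ℝ P x (e k), e k⟫_ℝ =
      ⟪P x, fderiv ℝ P x (P x)⟫_ℝ) (x : E) :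
    2 * ⟪P x, fderiv ℝ P x (P x)⟫_ℝ * ∑ k, ⟪fderiv ℝ P x (e k), e k⟫_ℝ +
        (1 + ‖P x‖ ^ 2) * ∑ k, ⟪fderiv ℝ (fderiv ℝ P) x (P x) (e k), e k⟫_ℝ =
      2 * ‖fderiv ℝ P x (P x)‖ ^ 2 + ⟪P x, fderiv ℝ (fderiv ℝ P) x (P x) (P x)⟫_ℝ := by
  have hPx : HasFDerivAt P (fderiv ℝ P x) x := (hP.differentiable (by simp) x).hasFDerivAt
  have hH : HasFDerivAt (fderiv ℝ P) (fderiv ℝ (fderiv ℝ P) x) x :=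
    ((hP.fderiv_right (m := (⊤ : ℕ∞)) (by simp)).differentiable (by simp) x).hasFDerivAt
  have hl := (hPx.norm_sq.const_add 1).mul (HasFDerivAt.fun_sum fun k (_ : k ∈ Finset.univ) =>
    (hH.clm_apply (hasFDerivAt_const (e k) x)).inner ℝ (hasFDerivAt_const (e k) x))
  have hr := hPx.inner ℝ (hH.clm_apply hPx)
  rw [← funext heq] at hr
  have h := DFunLike.congr_fun (hl.unique hr) (P x)
  simp [_root_.sum_apply, inner_add_right] at h
  have := hsymm x (fderiv ℝ P x (P x)) (P x)
  rw [real_inner_self_eq_norm_sq, real_inner_comm] at this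
  linarith

/-- Second-order condition along a line, with `P` the gradient of `u` along the line. -/
theorem angle_sub_barrier_second_deriv {P h : ℝ → E} {k y b : E} {u : ℝ → ℝ} {α β c u₀ : ℝ}
    (hP : ∀ t, HasDerivAt P (h t) t) (hh : HasDerivAt h k 0)
    (hu : ∀ t, HasDerivAt u ⟪P t, b⟫_ℝ t)
    (hmin : IsLocalMin (fun t => (√(1 + ‖P t‖ ^ 2))⁻¹ -
      c * (Real.exp (1 - α * ‖y + t • b‖ ^ 2 - β * (u t - u₀)) - 1)) 0) :
    0 ≤ (√(1 + ‖P 0‖ ^ 2))⁻¹ ^ 5 * (3 * ⟪P 0, h 0⟫_ℝ ^ 2 - (1 + ‖P 0‖ ^ 2) *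
      (‖h 0‖ ^ 2 + ⟪P 0, k⟫_ℝ)) -
      c * Real.exp (1 - α * ‖y‖ ^ 2 - β * (u 0 - u₀)) *
        (⟪(2 * α) • y + β • P 0, b⟫_ℝ ^ 2 - (2 * α * ‖b‖ ^ 2 + β * ⟪h 0, b⟫_ℝ)) := by
  set ν : ℝ → ℝ := fun t => (√(1 + ‖P t‖ ^ 2))⁻¹ with hν
  set φ : ℝ → ℝ := fun t => 1 - α * ‖y + t • b‖ ^ 2 - β * (u t - u₀) with hφ
  set w : ℝ → E := fun t => (2 * α) • (y + t • b) + β • P t with hw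
  have hline : ∀ t : ℝ, HasDerivAt (fun t : ℝ => y + t • b) b t := fun t => by
    simpa using ((hasDerivAt_id t).smul_const b).const_add y
  have hνd : ∀ t, HasDerivAt ν (-(ν t ^ 3) * ⟪P t, h t⟫_ℝ) t := fun t =>
    hasDerivAt_inv_sqrt_one_add_norm_sq (hP t)
  have hφd : ∀ t, HasDerivAt φ (-⟪w t, b⟫_ℝ) t := fun t => by
    have h := (((hline t).norm_sq.const_mul α).const_sub 1).sub
      (((hu t).sub_const u₀).const_mul β)
    refine h.congr_deriv ?_
    simp only [hw, inner_add_left, inner_smul_left, RCLike.conj_to_real]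
    ring
  have hwd : HasDerivAt w ((2 * α) • b + β • h 0) 0 :=
    ((hline 0).const_smul (2 * α)).add ((hP 0).const_smul β)
  have hf : ∀ t, HasDerivAt (fun t => ν t - c * (Real.exp (φ t) - 1))
      (-(ν t ^ 3) * ⟪P t, h t⟫_ℝ + c * (Real.exp (φ t) * ⟪w t, b⟫_ℝ)) t := fun t => by
    refine ((hνd t).sub (((hφd t).exp.sub_const 1).const_mul c)).congr_deriv ?_
    ring
  have hf' := (((hνd 0).fun_pow 3).fun_neg.fun_mul ((hP 0).inner ℝ hh)).fun_add
    (((hφd 0).exp.fun_mul (hwd.inner ℝ (hasDerivAt_const 0 b))).const_mul c)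
  have hnonneg := deriv_deriv_nonneg_of_isLocalMin hmin hf hf'
  have hw0 : w 0 = (2 * α) • y + β • P 0 := by simp [hw]
  have hφ0 : 1 - α * ‖y‖ ^ 2 - β * (u 0 - u₀) = φ 0 := by simp [hφ]
  have hν2 : ν 0 ^ 2 * (1 + ‖P 0‖ ^ 2) = 1 := by
    rw [hν]
    simp only [inv_pow]
    rw [Real.sq_sqrt (by positivity)]
    field_simp
  rw [← hw0, hφ0]
  simp only [inner_zero_right, inner_add_left, inner_smul_left, real_inner_self_eq_norm_sq,
    RCLike.conj_to_real] at hnonneg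
  norm_num at hnonneg
  linear_combination hnonneg + ν 0 ^ 3 * (‖h 0‖ ^ 2 + ⟪P 0, k⟫_ℝ) * hν2

end Calculus

/-- Second-order condition at a contact point between the angle function of a minimal graph and
an exponential barrier. -/
theorem barrier_contact_estimate [CompleteSpace E] (e : OrthonormalBasis ι ℝ E) {u : E → ℝ}
    (hu : ContDiff ℝ (⊤ : ℕ∞) u)
    (heq : ∀ x, (1 + ‖gradient u x‖ ^ 2) * ∑ k, ⟪fderiv ℝ (gradient u) x (e k), e k⟫_ℝ =
      ⟪gradient u x, fderiv ℝ (gradient u) x (gradient u x)⟫_ℝ)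
    {α β c : ℝ} (hα : 0 ≤ α) (hc : 0 < c) {x₀ x : E}
    (hmin : IsLocalMin (fun y => (√(1 + ‖gradient u y‖ ^ 2))⁻¹ -
      c * (Real.exp (1 - α * ‖y - x₀‖ ^ 2 - β * (u y - u x₀)) - 1)) x) :
    β ^ 2 * ‖gradient u x‖ ^ 2 + 4 * α * β * ⟪x - x₀, gradient u x⟫_ℝ ≤
      2 * α * Fintype.card ι * (1 + ‖gradient u x‖ ^ 2) := by
  set P := gradient u with hPdef
  have hP : ContDiff ℝ (⊤ : ℕ∞) P := contDiff_gradient hu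
  have hsymm : ∀ x a b, ⟪fderiv ℝ P x a, b⟫_ℝ = ⟪fderiv ℝ P x b, a⟫_ℝ :=
    inner_fderiv_gradient_comm hu
  have hPd : ∀ y, HasFDerivAt P (fderiv ℝ P y) y := fun y =>
    (hP.differentiable (by simp) y).hasFDerivAt
  have hHd : HasFDerivAt (fderiv ℝ P) (fderiv ℝ (fderiv ℝ P) x) x :=
    ((hP.fderiv_right (m := (⊤ : ℕ∞)) (by simp)).differentiable (by simp) x).hasFDerivAt
  have hud : ∀ y, HasFDerivAt u (innerSL ℝ (P y)) y := fun y => by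
    refine (hu.differentiable (by simp) y).hasFDerivAt.congr_fderiv ?_
    ext a
    simp [hPdef, gradient]
  set w := (2 * α) • (x - x₀) + β • P x with hw
  have hν0 : 0 < (√(1 + ‖P x‖ ^ 2))⁻¹ := inv_pos.2 (Real.sqrt_pos.2 (by positivity))
  set b := graphFrame e (P x)
  set H := fderiv ℝ P x
  set T := fderiv ℝ (fderiv ℝ P) x
  have htest : ∀ b : E, 0 ≤ (√(1 + ‖P x‖ ^ 2))⁻¹ ^ 5 * (3 * ⟪P x, H b⟫_ℝ ^ 2 - (1 + ‖P x‖ ^ 2) *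
      (‖H b‖ ^ 2 + ⟪P x, T b b⟫_ℝ)) -
      c * Real.exp (1 - α * ‖x - x₀‖ ^ 2 - β * (u x - u x₀)) *
        (⟪w, b⟫_ℝ ^ 2 - (2 * α * ‖b‖ ^ 2 + β * ⟪H b, b⟫_ℝ)) := by
    intro b
    have hline : ∀ t : ℝ, HasDerivAt (fun t : ℝ => x + t • b) b t := fun t => by
      simpa using ((hasDerivAt_id t).smul_const b).const_add x
    have hPl : ∀ t : ℝ, HasDerivAt (fun t : ℝ => P (x + t • b)) (fderiv ℝ P (x + t • b) b) t :=
      fun t => (hPd _).comp_hasDerivAt t (hline t)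
    have hul : ∀ t : ℝ, HasDerivAt (fun t : ℝ => u (x + t • b)) ⟪P (x + t • b), b⟫_ℝ t :=
      fun t => by simpa [Function.comp_def] using (hud _).comp_hasDerivAt t (hline t)
    have hHl : HasDerivAt (fun t : ℝ => fderiv ℝ P (x + t • b) b) (T b b) 0 := by
      have hx : HasFDerivAt (fderiv ℝ P) T (x + (0 : ℝ) • b) := by simpa using hHd
      have hxl : HasDerivAt (fun t : ℝ => fderiv ℝ P (x + t • b)) (T b) 0 :=
        hx.comp_hasDerivAt (0 : ℝ) (hline 0)
      simpa using hxl.clm_apply (hasDerivAt_const (0 : ℝ) b)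
    have hloc : IsLocalMin (fun t : ℝ => (√(1 + ‖P (x + t • b)‖ ^ 2))⁻¹ -
        c * (Real.exp (1 - α * ‖(x - x₀) + t • b‖ ^ 2 - β * (u (x + t • b) - u x₀)) - 1)) 0 := by
      have hx0 : x = x + (0 : ℝ) • b := by simp
      rw [hx0] at hmin
      have := hmin.comp_continuous (g := fun t : ℝ => x + t • b) (hline 0).continuousAt
      simpa [Function.comp_def, add_sub_right_comm] using this
    simpa using angle_sub_barrier_second_deriv hPl hHl hul hloc
  have hsum := Finset.sum_nonneg fun k (_ : k ∈ Finset.univ) => htest (b k)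
  rw [Finset.sum_sub_distrib, ← Finset.mul_sum, ← Finset.mul_sum] at hsum
  have hTsymm : ∀ a b, T a b = T b a := by
    refine hP.contDiffAt.isSymmSndFDerivAt ?_
    simp only [minSmoothness_of_isRCLikeNormedField]
    exact WithTop.coe_le_coe.2 (le_top : (2 : ℕ∞) ≤ ⊤)
  have hangle := sum_graphFrame_angle_nonpos e (P x) H T (hsymm x) hTsymm
    (inner_fderiv_fderiv_comm hP hsymm x) (heq x) (fderiv_minimal_equation e hP hsymm heq x)
  have hS : ∑ k, (⟪w, b k⟫_ℝ ^ 2 - (2 * α * ‖b k‖ ^ 2 + β * ⟪H (b k), b k⟫_ℝ)) ≤ 0 := by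
    have hpos : 0 < c * Real.exp (1 - α * ‖x - x₀‖ ^ 2 - β * (u x - u x₀)) := by positivity
    have := mul_nonpos_of_nonneg_of_nonpos (pow_nonneg hν0.le 5) hangle
    by_contra! hcon
    have := mul_pos hpos hcon
    linarith
  have hHb : ∑ k, ⟪H (b k), b k⟫_ℝ = 0 := by
    have h := sum_graphFrame e (P x) ((innerSL ℝ).comp H)
    simp only [ContinuousLinearMap.comp_apply, innerSL_apply_apply] at h
    rw [h, real_inner_comm (P x), ← heq x]
    field_simp
    ring
  rw [Finset.sum_sub_distrib, Finset.sum_add_distrib, ← Finset.mul_sum, ← Finset.mul_sum, hHb,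
    sum_inner_graphFrame_sq] at hS
  have hcard := mul_le_mul_of_nonneg_left (sum_norm_graphFrame_sq e (P x))
    (by positivity : 0 ≤ 2 * α)
  set y := x - x₀
  have hwx : w = (2 * α) • y + β • P x := rfl
  have hwn : ‖w‖ ^ 2 = 4 * α ^ 2 * ‖y‖ ^ 2 + 4 * α * β * ⟪y, P x⟫_ℝ + β ^ 2 * ‖P x‖ ^ 2 := by
    rw [hwx, norm_add_sq_real]
    simp [norm_smul, mul_pow, inner_smul_left, inner_smul_right]
    ring
  have hwp : ⟪w, P x⟫_ℝ = 2 * α * ⟪y, P x⟫_ℝ + β * ‖P x‖ ^ 2 := by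
    rw [hwx, inner_add_left, inner_smul_left, inner_smul_left, real_inner_self_eq_norm_sq]
    simp
  have hCS : ⟪y, P x⟫_ℝ ^ 2 ≤ ‖y‖ ^ 2 * ‖P x‖ ^ 2 := by
    rw [← mul_pow, ← sq_abs]
    have := abs_real_inner_le_norm y (P x)
    gcongr
  have hq : (0 : ℝ) < 1 + ‖P x‖ ^ 2 := by positivity
  have hmain : ‖w‖ ^ 2 * (1 + ‖P x‖ ^ 2) - ⟪w, P x⟫_ℝ ^ 2 ≤
      2 * α * Fintype.card ι * (1 + ‖P x‖ ^ 2) := by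
    have h : ‖w‖ ^ 2 - ⟪w, P x⟫_ℝ ^ 2 / (1 + ‖P x‖ ^ 2) ≤ 2 * α * Fintype.card ι := by
      linarith
    have := mul_le_mul_of_nonneg_right h hq.le
    rwa [sub_mul, div_mul_cancel₀ _ hq.ne'] at this
  rw [hwn, hwp] at hmain
  nlinarith [mul_le_mul_of_nonneg_left hCS (by positivity : 0 ≤ 4 * α ^ 2),
    mul_nonneg (sq_nonneg α) (sq_nonneg ‖y‖)]

theorem exists_pos_mul_exp_one_add_lt {a b : ℝ} (hab : a < b) :
    ∃ s, 0 < s ∧ s < 1 ∧ a * (Real.exp (1 + s) - 1) < b * (Real.exp 1 - 1) := by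
  have hcont : Continuous fun s : ℝ => a * (Real.exp (1 + s) - 1) := by fun_prop
  have he : 1 < Real.exp 1 := Real.one_lt_exp_iff.2 one_pos
  have h0 : a * (Real.exp (1 + 0) - 1) < b * (Real.exp 1 - 1) := by
    rw [add_zero]
    exact mul_lt_mul_of_pos_right hab (by linarith)
  have hev : ∀ᶠ s in 𝓝[>] (0 : ℝ), a * (Real.exp (1 + s) - 1) < b * (Real.exp 1 - 1) :=
    nhdsWithin_le_nhds (hcont.continuousAt.eventually_lt_const h0)
  obtain ⟨s, hs, hs'⟩ := (hev.and (Ioo_mem_nhdsGT one_pos)).exists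
  exact ⟨s, hs'.1, hs'.2, hs⟩

theorem barrier_estimate_false {g d θ δ R N q i : ℝ} (hg : 0 ≤ g) (hd : d ≤ 2 * R) (hR : 0 < R)
    (hN : 0 ≤ N) (hq : q = 1 + g ^ 2) (hθ : 0 < θ) (hθ1 : θ < 1) (hqθ : 1 < θ ^ 2 * q)
    (hδ : δ = (1 - θ ^ 2) / (16 * (N + 1))) (hi : -(d * g) ≤ i)
    (h : (1 / (δ * R)) ^ 2 * g ^ 2 + 4 * (1 / R ^ 2) * (1 / (δ * R)) * i ≤
      2 * (1 / R ^ 2) * N * q) : False := by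
  set κ := 1 - θ ^ 2 with hκ
  have hκ0 : 0 < κ := by nlinarith
  have hκ1 : κ ≤ 1 := by nlinarith
  have hδ0 : 0 < δ := by rw [hδ]; positivity
  have hδκ : δ * (16 * (N + 1)) = κ := by rw [hδ]; field_simp
  have hκq : κ * q ≤ g ^ 2 := by
    have : κ * q = q - θ ^ 2 * q := by rw [hκ]; ring
    linarith
  have hg2 : κ ≤ g ^ 2 := by nlinarith [mul_nonneg hκ0.le (sq_nonneg g)]
  have hκg : κ ≤ g := by
    by_contra! hcon
    nlinarith
  have hδg : 16 * δ ≤ g := by nlinarith [mul_nonneg hδ0.le hN]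
  have h' : g ^ 2 + 4 * δ / R * i ≤ 2 * N * δ ^ 2 * q := by
    have := mul_le_mul_of_nonneg_right h (by positivity : 0 ≤ δ ^ 2 * R ^ 2)
    field_simp at this ⊢
    linarith
  have hi' : -(8 * δ * g) ≤ 4 * δ / R * i := by
    have h₁ : -(2 * R * g) ≤ i := by nlinarith
    calc -(8 * δ * g) = 4 * δ / R * (-(2 * R * g)) := by field_simp; ring
      _ ≤ _ := by gcongr
  have hq' : 2 * N * δ ^ 2 * q ≤ g ^ 2 / 8 := by
    have h₁ : 16 * N * δ ≤ κ := by nlinarith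
    have h₂ : δ ≤ 1 := by nlinarith [mul_nonneg hδ0.le hN]
    have hq0 : 0 < q := by rw [hq]; positivity
    calc 2 * N * δ ^ 2 * q = (16 * N * δ) * δ * q / 8 := by ring
      _ ≤ κ * 1 * q / 8 := by gcongr
      _ ≤ g ^ 2 / 8 := by linarith
  nlinarith

theorem gradient_eq_zero_of_minimal_of_sublinear [ProperSpace E] [CompleteSpace E]
    (e : OrthonormalBasis ι ℝ E) {u : E → ℝ} (hu : ContDiff ℝ (⊤ : ℕ∞) u)
    (heq : ∀ x, (1 + ‖gradient u x‖ ^ 2) * ∑ k, ⟪fderiv ℝ (gradient u) x (e k), e k⟫_ℝ =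
      ⟪gradient u x, fderiv ℝ (gradient u) x (gradient u x)⟫_ℝ)
    (x₀ : E) (hlow : ∀ ε : ℝ, 0 < ε → ∃ R : ℝ, 0 < R ∧
      ∀ y ∈ Metric.closedBall x₀ (2 * R), u x₀ - ε * R ≤ u y) :
    gradient u x₀ = 0 := by
  by_contra hne
  set ν : E → ℝ := fun y => (√(1 + ‖gradient u y‖ ^ 2))⁻¹ with hν
  have hνpos : ∀ y, 0 < ν y := fun y => inv_pos.2 (Real.sqrt_pos.2 (by positivity))
  have hν1 : ν x₀ < 1 := by
    refine inv_lt_one_of_one_lt₀ (Real.lt_sqrt_of_sq_lt ?_)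
    have : 0 < ‖gradient u x₀‖ := norm_pos_iff.2 hne
    nlinarith
  set θ := (1 + ν x₀) / 2 with hθdef
  have hθ : 0 < θ := by have := hνpos x₀; positivity
  have hθ1 : θ < 1 := by linarith
  obtain ⟨s, hs0, hs1, hs⟩ := exists_pos_mul_exp_one_add_lt (by linarith : ν x₀ < θ)
  set N : ℝ := (Fintype.card ι : ℝ) with hN
  set δ := (1 - θ ^ 2) / (16 * (N + 1)) with hδ
  have hδ0 : 0 < δ := by
    have : 0 < 1 - θ ^ 2 := by nlinarith
    positivity
  obtain ⟨R, hR, hRlow⟩ := hlow (s * δ) (by positivity)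
  set S := Real.exp (1 + s) - 1 with hS
  have hS0 : 0 < S := by
    have := Real.one_lt_exp_iff.2 (by linarith : 0 < 1 + s)
    linarith
  set φ : E → ℝ := fun y => 1 - 1 / R ^ 2 * ‖y - x₀‖ ^ 2 - 1 / (δ * R) * (u y - u x₀) with hφ
  set G : E → ℝ := fun y => ν y - θ / S * (Real.exp (φ y) - 1) with hG
  have hcont : Continuous G := by
    have h₁ : Continuous (gradient u) := (contDiff_gradient hu).continuous
    have h₂ : Continuous u := hu.continuous
    have h₃ : Continuous ν := by
      refine Continuous.inv₀ (by fun_prop) fun y => ?_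
      exact (Real.sqrt_pos.2 (by positivity)).ne'
    fun_prop
  obtain ⟨x, hx, hxmin⟩ := (isCompact_closedBall x₀ (2 * R)).exists_isMinOn
    ⟨x₀, Metric.mem_closedBall_self (by positivity)⟩ hcont.continuousOn
  have hGx : G x < 0 := by
    refine (hxmin (Metric.mem_closedBall_self (by positivity))).trans_lt ?_
    have : ν x₀ < θ / S * (Real.exp 1 - 1) := by
      rw [div_mul_eq_mul_div, lt_div_iff₀ hS0]
      exact hs
    simpa [hG, hφ] using this
  have hd : ‖x - x₀‖ ≤ 2 * R := by simpa [dist_eq_norm] using hx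
  have hφs : φ x ≤ 1 - 1 / R ^ 2 * ‖x - x₀‖ ^ 2 + s := by
    have h₁ : -(s * δ * R) ≤ u x - u x₀ := by linarith [hRlow x hx]
    have h₂ : 1 / (δ * R) * -(s * δ * R) ≤ 1 / (δ * R) * (u x - u x₀) := by gcongr
    have h₃ : 1 / (δ * R) * -(s * δ * R) = -s := by field_simp
    simp only [hφ]
    linarith
  have hc : 0 < θ / S := by positivity
  have hφ0 : 0 < φ x := by
    by_contra! hcon
    have h₁ : Real.exp (φ x) - 1 ≤ 0 := by linarith [Real.exp_le_one_iff.2 hcon]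
    have h₂ := mul_nonpos_of_nonneg_of_nonpos hc.le h₁
    have h₃ := hνpos x
    simp only [hG] at hGx
    linarith
  have hball : ‖x - x₀‖ < 2 * R := by
    refine lt_of_le_of_ne hd fun h => ?_
    have h₁ : 1 / R ^ 2 * ‖x - x₀‖ ^ 2 = 4 := by rw [h]; field_simp; norm_num
    linarith
  have hloc : IsLocalMin G x := by
    refine hxmin.isLocalMin (mem_of_superset ?_ Metric.ball_subset_closedBall)
    exact Metric.isOpen_ball.mem_nhds (by simpa [dist_eq_norm] using hball)
  have hest := barrier_contact_estimate e hu heq (by positivity : 0 ≤ 1 / R ^ 2) hc hloc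
  have hνθ : ν x < θ := by
    have h₁ : φ x ≤ 1 + s := by
      have : 0 ≤ 1 / R ^ 2 * ‖x - x₀‖ ^ 2 := by positivity
      linarith
    have h₂ : Real.exp (φ x) - 1 ≤ S := sub_le_sub_right (Real.exp_le_exp.2 h₁) 1
    have h₃ : θ / S * (Real.exp (φ x) - 1) ≤ θ / S * S := by gcongr
    rw [div_mul_cancel₀ _ hS0.ne'] at h₃
    simp only [hG] at hGx
    linarith
  have hqθ : 1 < θ ^ 2 * (1 + ‖gradient u x‖ ^ 2) := by
    have h₁ : ν x ^ 2 * (1 + ‖gradient u x‖ ^ 2) = 1 := by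
      simp only [hν, inv_pow]
      rw [Real.sq_sqrt (by positivity)]
      field_simp
    have h₂ : ν x ^ 2 < θ ^ 2 := by
      have := hνpos x
      gcongr
    calc (1 : ℝ) = ν x ^ 2 * (1 + ‖gradient u x‖ ^ 2) := h₁.symm
      _ < θ ^ 2 * (1 + ‖gradient u x‖ ^ 2) := mul_lt_mul_of_pos_right h₂ (by positivity)
  exact barrier_estimate_false (norm_nonneg _) hd hR (Nat.cast_nonneg _) rfl hθ hθ1 hqθ hδ
    (neg_le_of_abs_le (abs_real_inner_le_norm _ _)) hest

theorem exists_lower_bound_of_sublinear {F : Type*} [NormedAddCommGroup F] [ProperSpace F]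
    {u : F → ℝ} (hu : Continuous u)
    (hsub : Tendsto (fun x => max (-(u x)) 0 / ‖x‖) (Bornology.cobounded F) (𝓝 0)) (x₀ : F)
    {ε : ℝ} (hε : 0 < ε) :
    ∃ R : ℝ, 0 < R ∧ ∀ y ∈ Metric.closedBall x₀ (2 * R), u x₀ - ε * R ≤ u y := by
  have hev : ∀ᶠ x in Bornology.cobounded F, max (-(u x)) 0 / ‖x‖ < ε / 6 :=
    hsub.eventually_lt_const (by positivity)
  obtain ⟨r, -, hr⟩ := (Metric.hasBasis_cobounded_compl_closedBall (0 : F)).eventually_iff.1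
    (hev.and (tendsto_norm_cobounded_atTop.eventually_gt_atTop 0))
  obtain ⟨M, hM⟩ := ((isCompact_closedBall (0 : F) r).bddBelow_image hu.continuousOn)
  have hlarge : ∀ᶠ R : ℝ in atTop, 0 < R ∧ ‖x₀‖ ≤ R ∧ u x₀ - M ≤ ε * R ∧
      2 * u x₀ ≤ ε * R := by
    have hlin : Tendsto (fun R : ℝ => ε * R) atTop atTop := tendsto_id.const_mul_atTop hε
    filter_upwards [eventually_gt_atTop 0, eventually_ge_atTop ‖x₀‖,
      hlin.eventually_ge_atTop (u x₀ - M), hlin.eventually_ge_atTop (2 * u x₀)]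
      with R h₁ h₂ h₃ h₄ using ⟨h₁, h₂, h₃, h₄⟩
  obtain ⟨R, hR, hRx, hRM, hRu⟩ := hlarge.exists
  refine ⟨R, hR, fun y hy => ?_⟩
  by_cases hyr : y ∈ Metric.closedBall (0 : F) r
  · linarith [hM (Set.mem_image_of_mem u hyr)]
  · obtain ⟨hdiv, h0⟩ := hr hyr
    have hy3 : ‖y‖ ≤ 3 * R := by
      have h₁ : ‖y - x₀‖ ≤ 2 * R := by simpa [dist_eq_norm] using hy
      linarith [norm_le_norm_add_norm_sub' y x₀]
    rw [div_lt_iff₀ h0] at hdiv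
    have := le_max_left (-(u y)) 0
    nlinarith

end Graph

theorem stmt_15 (n : ℕ) (u : EuclideanSpace ℝ (Fin n) → ℝ)
    (hsmooth : ContDiff ℝ (⊤ : ℕ∞) u)
    (hmin : ∀ x, ∑ i : Fin n,
      fderiv ℝ (fun y => (Real.sqrt (1 + ‖gradient u y‖ ^ 2))⁻¹ * gradient u y i) x
        (EuclideanSpace.single i 1) = 0)
    (hsub : Tendsto (fun x => max (-(u x)) 0 / ‖x‖)
      (Bornology.cobounded (EuclideanSpace ℝ (Fin n))) (𝓝 0)) :
    ∃ c : ℝ, ∀ x, u x = c := by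
  have heq := fun x => one_add_norm_sq_mul_laplacian_eq (EuclideanSpace.basisFun (Fin n) ℝ)
    ((contDiff_gradient hsmooth).differentiable (by simp) x)
    (inner_fderiv_gradient_comm hsmooth x)
    (by simpa only [EuclideanSpace.basisFun_apply, EuclideanSpace.inner_single_left, map_one,
      one_mul] using hmin x)
  have hgrad : ∀ x, gradient u x = 0 := fun x =>
    gradient_eq_zero_of_minimal_of_sublinear _ hsmooth heq x fun ε hε =>
      exists_lower_bound_of_sublinear hsmooth.continuous hsub x hε
  refine ⟨u 0, fun x => ?_⟩
  refine is_const_of_fderiv_eq_zero (hsmooth.differentiable (by simp)) (fun y => ?_) x 0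
  rw [← toDual_gradient, hgrad, map_zero]
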